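/- The subStraTT logical relation is backward closed under reduction: if a ⇒* b and b ∈ ⟦A⟧_k, then a ∈ ⟦A⟧_k. -/

import Mathlib

/-! subStraTT without global definitions, in de Bruijn representation:
a single universe ⋆ with type-in-type, stratified dependent function types
`Πx:^j A. B`, abstractions, applications, the empty type and its eliminator.
Levels are natural numbers. -/

inductive Tm : Type
  | star
  | var (x : ℕ)
  | pi (j : ℕ) (A B : Tm)
  | lam (b : Tm)
  | app (b a : Tm)
  | bot
  | absurd (b : Tm)
  deriving DecidableEq

namespace Tm

/-- Shift free de Bruijn indices `≥ c` up by `d`. -/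
def shift (d c : ℕ) : Tm → Tm
  | star => star
  | var x => if x < c then var x else var (x + d)
  | pi j A B => pi j (shift d c A) (shift d (c + 1) B)
  | lam b => lam (shift d (c + 1) b)
  | app b a => app (shift d c b) (shift d c a)
  | bot => bot
  | absurd b => absurd (shift d c b)

/-- Substitute `u` for de Bruijn index `k` (decrementing greater indices). -/
def subst (k : ℕ) (u : Tm) : Tm → Tm
  | star => star
  | var x => if x < k then var x else if x = k then shift k 0 u else var (x - 1)
  | pi j A B => pi j (subst k u A) (subst (k + 1) u B)
  | lam b => lam (subst (k + 1) u b)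
  | app b a => app (subst k u b) (subst k u a)
  | bot => bot
  | absurd b => absurd (subst k u b)

end Tm

/-- Parallel reduction `a ⇒ b`: all visible β-redexes may be reduced
simultaneously in one step. -/
inductive Par : Tm → Tm → Prop
  | star : Par .star .star
  | var (x) : Par (.var x) (.var x)
  | bot : Par .bot .bot
  | pi {j A A' B B'} : Par A A' → Par B B' → Par (.pi j A B) (.pi j A' B')
  | lam {b b'} : Par b b' → Par (.lam b) (.lam b')
  | app {b b' a a'} : Par b b' → Par a a' → Par (.app b a) (.app b' a')
  | beta {b b' a a'} : Par b b' → Par a a' →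
      Par (.app (.lam b) a) (Tm.subst 0 a' b')
  | absurd {b b'} : Par b b' → Par (.absurd b) (.absurd b')

/-- `a ⇒* b`: reflexive–transitive closure of parallel reduction. -/
def Pars : Tm → Tm → Prop := Relation.ReflTransGen Par

/-- Joinability `a ⇔ b`: `a` and `b` parallel-reduce to a common term. -/
def Conv (a b : Tm) : Prop := ∃ c, Pars a c ∧ Pars b c

/-- Untyped definitional equality `a ≡ b`: the least reflexive, symmetric,
transitive congruence containing β-equivalence. -/
inductive DEq : Tm → Tm → Prop
  | refl (a) : DEq a a
  | sym : DEq a b → DEq b a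
  | trans : DEq a b → DEq b c → DEq a c
  | beta (b a) : DEq (.app (.lam b) a) (Tm.subst 0 a b)
  | pi {j A A' B B'} : DEq A A' → DEq B B' → DEq (.pi j A B) (.pi j A' B')
  | lam {b b'} : DEq b b' → DEq (.lam b) (.lam b')
  | app {b b' a a'} : DEq b b' → DEq a a' → DEq (.app b a) (.app b' a')
  | absurd {b b'} : DEq b b' → DEq (.absurd b) (.absurd b')

/-! The logical relation, stratified by well-founded induction on levels:
an inductive predicate `⟦A⟧ₖ` on closed types (`U`), parametrized by the
membership relation at strictly lower levels, together with a membership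
relation `a ∈ ⟦A⟧ₖ` (`elU`) defined by recursion on the derivation of `⟦A⟧ₖ`;
the knot is tied by well-founded recursion on the level `k` (`el`). -/

/-- Inductive predicate on closed types at level `k`, with rules for `⋆`, `⊥`,
stratified dependent function types (domain at a strictly lower level `j < k`,
codomain interpreted at all members of the domain), and closure under parallel
reduction. `el` is the membership relation at strictly lower levels. -/
inductive U (el : ℕ → Tm → Tm → Prop) : ℕ → Tm → Type
  | star {k} : U el k .star
  | bot {k} : U el k .bot
  | pi {k j A B} : j < k → U el j A →
      (∀ y, el j A y → U el k (Tm.subst 0 y B)) → U el k (.pi j A B)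
  | red {k A B} : Par A B → U el k B → U el k A

/-- Membership `a ∈ ⟦A⟧ₖ`, by recursion on the derivation of `⟦A⟧ₖ`:
`A ∈ ⟦⋆⟧ₖ` iff `⟦A⟧ₖ`; `a ∈ ⟦⊥⟧ₖ` is false; `f ∈ ⟦Πx:^j A. B⟧ₖ` iff for all
`y ∈ ⟦A⟧ⱼ`, `f y ∈ ⟦B{y/x}⟧ₖ`; membership is preserved along reduction. -/
def elU {el : ℕ → Tm → Tm → Prop} {k : ℕ} : {A : Tm} → U el k A → Tm → Prop
  | _, .star, a => Nonempty (U el k a)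
  | _, .bot, _ => False
  | _, .pi _ _ hB, f => ∀ y hy, elU (hB y hy) (Tm.app f y)
  | _, .red _ h, a => elU h a

/-- The membership relation `a ∈ ⟦A⟧ₖ`, tying the knot by well-founded
recursion on the level `k`. -/
def el (k : ℕ) (A a : Tm) : Prop :=
  ∃ h : U (fun j B b => if h' : j < k then el j B b else False) k A, elU h a
termination_by k
decreasing_by all_goals exact h'

/-- Membership at strictly lower levels than `k`. -/
def lowEl (k : ℕ) : ℕ → Tm → Tm → Prop :=
  fun j B b => if h' : j < k then el j B b else False

/-- The type interpretation `⟦A⟧ₖ` is defined (inhabited). -/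
def interpTy (k : ℕ) (A : Tm) : Prop :=
  Nonempty (U (lowEl k) k A)

theorem par_refl_aux (a : Tm) : Par a a := by
  induction a with
  | star => exact .star
  | var x => exact .var x
  | pi j A B ihA ihB => exact .pi ihA ihB
  | lam b ih => exact .lam ih
  | app b a ihb iha => exact .app ihb iha
  | bot => exact .bot
  | absurd b ih => exact .absurd ih

theorem elU_back_step {e : ℕ → Tm → Tm → Prop} {k : ℕ} {A : Tm} (h : U e k A) :
    ∀ {a b : Tm}, Par a b → elU h b → elU h a := by
  induction h with
  | star =>
    intro a b hab hb
    simp only [elU] at hb ⊢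
    exact hb.map (U.red hab)
  | bot =>
    intro a b _ hb
    simp only [elU] at hb
  | pi hj hA hB _ ihB =>
    intro a b hab hb
    simp only [elU] at hb ⊢
    exact fun y hy => ihB y hy (.app hab (par_refl_aux y)) (hb y hy)
  | red _ h ih =>
    intro a b hab hb
    simp only [elU] at hb ⊢
    exact ih hab hb

/-- **Backward closure of the logical relation under reduction**: if `a ⇒* b`
and `b ∈ ⟦A⟧ₖ` then `a ∈ ⟦A⟧ₖ`. -/
theorem lr_backward_closure {a b A : Tm} {k : ℕ}
    (hab : Pars a b) (hb : el k A b) : el k A a := by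
  induction hab using Relation.ReflTransGen.head_induction_on with
  | refl => exact hb
  | head hstep _ ih =>
    rw [el] at ih ⊢
    obtain ⟨h, hh⟩ := ih
    exact ⟨h, elU_back_step h hstep hh⟩
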